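/- The first derivative of d is strictly positive throughout the interval [5.33, 5.72]: d'(t) > 0 for all t with 5.33 ≤ t ≤ 5.72. -/

import Mathlib

open MeasureTheory

/-- `G₊(x) = |1 + e(x) + e(7x)|² = 3 + 2(cos 2πx + cos 12πx + cos 14πx)`. -/
noncomputable def Gp (x : ℝ) : ℝ :=
  3 + 2 * (Real.cos (2 * Real.pi * x) + Real.cos (12 * Real.pi * x) + Real.cos (14 * Real.pi * x))

/-- `G₋(x) = |1 + e(x) − e(7x)|² = 3 + 2(cos 2πx − cos 12πx − cos 14πx)`. -/
noncomputable def Gm (x : ℝ) : ℝ :=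
  3 + 2 * (Real.cos (2 * Real.pi * x) - Real.cos (12 * Real.pi * x) - Real.cos (14 * Real.pi * x))

/-- `d(t) = ∫₀^{1/2} (G₋ᵗ − G₊ᵗ)`, real powers (`0^t = 0` for `t ≠ 0`). -/
noncomputable def d (t : ℝ) : ℝ := ∫ x in (0:ℝ)..(1/2), (Gm x ^ t - Gp x ^ t)

section IntegerPolynomials

/-- Sum of integer polynomials given by their coefficient lists. -/
def lAdd : List ℤ → List ℤ → List ℤ
  | [], l => l
  | c :: p, [] => c :: p
  | c :: p, e :: q => (c + e) :: lAdd p q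

/-- Scalar multiple of a coefficient list. -/
def lSmul (c : ℤ) (l : List ℤ) : List ℤ := l.map (c * ·)

/-- Product of coefficient lists. -/
def lMul : List ℤ → List ℤ → List ℤ
  | [], _ => []
  | c :: p, l => lAdd (lSmul c l) (0 :: lMul p l)

/-- Power of a coefficient list. -/
def lPow (p : List ℤ) : ℕ → List ℤ
  | 0 => [1]
  | n + 1 => lMul p (lPow p n)

/-- The coefficient of degree `m`. -/
def lCoeff : List ℤ → ℤ → ℤ
  | [], _ => 0
  | c :: l, m => (if m = 0 then c else 0) + lCoeff l (m - 1)

/-- Sum of the absolute values of the coefficients. -/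
def lNorm : List ℤ → ℤ
  | [] => 0
  | c :: l => |c| + lNorm l

/-- Constant coefficient minus the absolute values of all others. -/
def lLower : List ℤ → ℤ
  | [] => 0
  | c :: l => c - lNorm l

/-- Value of a coefficient list at a point of a commutative ring. -/
def lEval {K : Type*} [CommRing K] : List ℤ → K → K
  | [], _ => 0
  | c :: l, x => c + x * lEval l x

variable {K : Type*} [CommRing K]

theorem lEval_add (p q : List ℤ) (x : K) : lEval (lAdd p q) x = lEval p x + lEval q x := by
  induction p generalizing q with
  | nil => simp [lAdd, lEval]
  | cons c p ih =>
    cases q with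
    | nil => simp [lAdd, lEval]
    | cons e q => simp only [lAdd, lEval, ih, Int.cast_add]; ring

theorem lEval_smul (c : ℤ) (p : List ℤ) (x : K) : lEval (lSmul c p) x = c * lEval p x := by
  induction p with
  | nil => simp [lSmul, lEval]
  | cons e p ih =>
    simp only [lSmul, List.map_cons, lEval, Int.cast_mul] at ih ⊢
    rw [ih]; ring

theorem lEval_mul (p q : List ℤ) (x : K) : lEval (lMul p q) x = lEval p x * lEval q x := by
  induction p with
  | nil => simp [lMul, lEval]
  | cons c p ih => simp only [lMul, lEval_add, lEval_smul, lEval, ih]; push_cast; ring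

theorem lEval_pow (p : List ℤ) (n : ℕ) (x : K) : lEval (lPow p n) x = lEval p x ^ n := by
  induction n with
  | zero => simp [lPow, lEval]
  | succ n ih => rw [lPow, lEval_mul, ih, pow_succ']

theorem abs_lEval_le (l : List ℤ) {s : ℝ} (hs : |s| ≤ 1) : |lEval l s| ≤ lNorm l := by
  induction l with
  | nil => simp [lEval, lNorm]
  | cons c l ih =>
    simp only [lEval, lNorm]
    push_cast
    refine (abs_add_le _ _).trans (add_le_add le_rfl ?_)
    rw [abs_mul]
    exact (mul_le_of_le_one_left (abs_nonneg _) hs).trans ih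

theorem lLower_le_lEval (l : List ℤ) {s : ℝ} (hs : |s| ≤ 1) : (lLower l : ℝ) ≤ lEval l s := by
  cases l with
  | nil => simp [lEval, lLower]
  | cons c l =>
    simp only [lEval, lLower]
    push_cast
    have h1 := abs_lEval_le l hs
    have h2 : |s * lEval l s| ≤ |lEval l s| := by
      rw [abs_mul]; exact mul_le_of_le_one_left (abs_nonneg _) hs
    linarith [neg_abs_le (s * lEval l s)]

end IntegerPolynomials

section Moments

open Complex in
/-- The constant Fourier coefficient of a trigonometric polynomial, read off by integration. -/
theorem integral_re_lEval (l : List ℤ) (m : ℤ) :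
    ∫ x in (0:ℝ)..(1/2),
      (exp (((-m * (2 * Real.pi * x) : ℝ) : ℂ) * I)
        * lEval l (exp (((2 * Real.pi * x : ℝ) : ℂ) * I))).re = (lCoeff l m : ℝ) / 2 := by
  have cont : ∀ l : List ℤ, Continuous
      (fun x : ℝ => lEval l (exp (((2 * Real.pi * x : ℝ) : ℂ) * I))) := by
    intro l
    induction l with
    | nil => simpa [lEval] using continuous_const
    | cons c l ih => simp only [lEval]; fun_prop
  induction l generalizing m with
  | nil => simp [lEval, lCoeff]
  | cons c l ih =>
    have h1 : ∀ x : ℝ, (exp (((-m * (2 * Real.pi * x) : ℝ) : ℂ) * I)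
        * lEval (c :: l) (exp (((2 * Real.pi * x : ℝ) : ℂ) * I))).re =
        c * Real.cos (2 * Real.pi * m * x) +
        (exp (((-(m - 1 : ℤ) * (2 * Real.pi * x) : ℝ) : ℂ) * I)
        * lEval l (exp (((2 * Real.pi * x : ℝ) : ℂ) * I))).re := by
      intro x
      rw [lEval, mul_add, ← mul_assoc (exp _) (exp _), ← Complex.exp_add, add_re]
      congr 1
      · rw [mul_comm, ← ofReal_intCast, re_ofReal_mul, exp_ofReal_mul_I_re, ← Real.cos_neg]
        congr 2; ring
      · congr 3; push_cast; ring
    simp_rw [h1]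
    rw [intervalIntegral.integral_add, ih, lCoeff]
    · have h2 : ∫ x in (0:ℝ)..(1/2), (c:ℝ) * Real.cos (2 * Real.pi * m * x)
          = ((if m = 0 then c else 0 : ℤ) : ℝ) / 2 := by
        split_ifs with hm
        · simp [hm]; ring
        · have : (2 * Real.pi * m : ℝ) ≠ 0 := by positivity
          rw [intervalIntegral.integral_const_mul, intervalIntegral.integral_comp_mul_left _ this,
            integral_cos, show 2 * Real.pi * m * (1 / 2) = m * Real.pi by ring, Real.sin_int_mul_pi]
          simp
      rw [h2]; push_cast; ring
    · exact Continuous.intervalIntegrable (by fun_prop) _ _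
    · refine Continuous.intervalIntegrable ?_ _ _
      have := cont l
      fun_prop

/-- `3 + 2(cos 2πx + σ(cos 12πx + cos 14πx))`. -/
noncomputable def gFun (σ : ℤ) (x : ℝ) : ℝ :=
  3 + 2 * (Real.cos (2 * Real.pi * x) + σ * Real.cos (12 * Real.pi * x)
    + σ * Real.cos (14 * Real.pi * x))

/-- The Laurent polynomial `gFun σ - 5` in `e(x)`, multiplied by `e(7x)`. -/
def gPoly (σ : ℤ) : List ℤ := [σ, σ, 0, 0, 0, 0, 1, -2, 1, 0, 0, 0, 0, σ, σ]

/-- Twice the `k`-th moment of `gFun σ - 5`. -/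
def gMoment (σ : ℤ) (k : ℕ) : ℤ := lCoeff (lPow (gPoly σ) k) (7 * k)

open Complex in
theorem gFun_sub_five_eq (σ : ℤ) (x : ℝ) :
    ((gFun σ x - 5 : ℝ) : ℂ) = exp (((-7 * (2 * Real.pi * x) : ℝ) : ℂ) * I)
        * lEval (gPoly σ) (exp (((2 * Real.pi * x : ℝ) : ℂ) * I)) := by
  have hz : exp (((-7 * (2 * Real.pi * x) : ℝ) : ℂ) * I)
      = (exp (((2 * Real.pi * x : ℝ) : ℂ) * I) ^ 7)⁻¹ := by
    rw [← Complex.exp_nat_mul, ← Complex.exp_neg]; congr 1; push_cast; ring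
  have hcos : ∀ n : ℕ, ((Real.cos (n * (2 * Real.pi * x)) : ℝ) : ℂ)
      = (exp (((2 * Real.pi * x : ℝ) : ℂ) * I) ^ n
        + (exp (((2 * Real.pi * x : ℝ) : ℂ) * I) ^ n)⁻¹) / 2 := by
    intro n
    rw [← Complex.exp_nat_mul, ← Complex.exp_neg, ofReal_cos, Complex.cos]
    congr 3 <;> (push_cast; ring_nf)
  have e1 := hcos 1
  have e6 := hcos 6
  have e7 := hcos 7
  rw [hz, gFun, show 12 * Real.pi * x = (6 : ℕ) * (2 * Real.pi * x) by push_cast; ring,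
    show 14 * Real.pi * x = (7 : ℕ) * (2 * Real.pi * x) by push_cast; ring,
    show Real.cos (2 * Real.pi * x) = Real.cos ((1 : ℕ) * (2 * Real.pi * x)) by simp]
  rw [ofReal_sub, ofReal_add, ofReal_mul, ofReal_add, ofReal_add, ofReal_mul, ofReal_mul, e1, e6, e7]
  have hne := Complex.exp_ne_zero (((2 * Real.pi * x : ℝ) : ℂ) * I)
  generalize exp (((2 * Real.pi * x : ℝ) : ℂ) * I) = z at hne ⊢
  simp only [gPoly, lEval]
  push_cast
  field_simp
  ring

theorem integral_gFun_pow (σ : ℤ) (k : ℕ) :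
    ∫ x in (0:ℝ)..(1/2), (gFun σ x / 5 - 1) ^ k = gMoment σ k / (2 * 5 ^ k) := by
  have h : ∀ x : ℝ, (gFun σ x / 5 - 1) ^ k = (5 ^ k)⁻¹ *
      (Complex.exp (((-(7 * k : ℤ) * (2 * Real.pi * x) : ℝ) : ℂ) * Complex.I)
        * lEval (lPow (gPoly σ) k)
          (Complex.exp (((2 * Real.pi * x : ℝ) : ℂ) * Complex.I))).re := by
    intro x
    have h1 : (gFun σ x / 5 - 1) ^ k = (5 ^ k)⁻¹ * (gFun σ x - 5) ^ k := by
      rw [← inv_pow, ← mul_pow]; congr 1; ring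
    rw [h1, ← Complex.ofReal_re ((gFun σ x - 5) ^ k), Complex.ofReal_pow, gFun_sub_five_eq,
      mul_pow, ← lEval_pow, ← Complex.exp_nat_mul]
    congr 4; push_cast; ring_nf
  simp_rw [h]
  rw [intervalIntegral.integral_const_mul, integral_re_lEval, gMoment]
  field_simp

end Moments

section BinomialSeries

/-- The binomial coefficient `t(t-1)⋯(t-k+1)/k!`. -/
noncomputable def binom (t : ℝ) : ℕ → ℝ
  | 0 => 1
  | k + 1 => binom t k * (t - k) / (k + 1)

/-- The derivative of `binom t k` with respect to `t`. -/
noncomputable def binomDeriv (t : ℝ) : ℕ → ℝ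
  | 0 => 0
  | k + 1 => (binomDeriv t k * (t - k) + binom t k) / (k + 1)

open Complex in
theorem hasSum_cpow_mul_log (t α β : ℝ) {z : ℂ} (hz : z ∈ Metric.ball (0:ℂ) 1) :
    HasSum (fun k : ℕ => ((α * binomDeriv t k + β * binom t k : ℝ) : ℂ) * z ^ k)
      ((1 + z) ^ (t : ℂ) * (α * log (1 + z) + β)) := by
  set f : ℂ → ℂ := fun z => (1 + z) ^ (t : ℂ) * (α * log (1 + z) + β) with hf
  have slit : ∀ z ∈ Metric.ball (0:ℂ) 1, 1 + z ∈ slitPlane := fun z hz =>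
    mem_slitPlane_of_norm_lt_one (by simpa using hz)
  have hder : ∀ (s p q : ℂ), ∀ z ∈ Metric.ball (0:ℂ) 1,
      HasDerivAt (fun z : ℂ => (1 + z) ^ s * (p * log (1 + z) + q))
        ((1 + z) ^ (s - 1) * (s * (p * log (1 + z) + q) + p)) z := by
    intro s p q z hz
    have h0 : HasDerivAt (fun z : ℂ => 1 + z) 1 z := (hasDerivAt_id z).const_add 1
    have h1 := h0.cpow_const (c := s) (slit z hz)
    have h2 := ((h0.clog (slit z hz)).const_mul p).add_const q
    have hne : 1 + z ≠ 0 := slitPlane_ne_zero (slit z hz)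
    refine (h1.mul h2).congr_deriv ?_
    rw [cpow_sub _ _ hne, cpow_one]
    field_simp
  have hiter : ∀ n : ℕ, ∀ z ∈ Metric.ball (0:ℂ) 1, iteratedDeriv n f z =
      (1 + z) ^ ((t : ℂ) - n) * ((n.factorial * (α * binom t n) : ℂ) * log (1 + z)
        + n.factorial * (α * binomDeriv t n + β * binom t n)) := by
    intro n
    induction n with
    | zero => intro z hz; simp [hf, binom, binomDeriv]
    | succ n ih =>
      intro z hz
      rw [iteratedDeriv_succ]
      have hev : iteratedDeriv n f =ᶠ[nhds z] fun z => (1 + z) ^ ((t : ℂ) - n) *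
          ((n.factorial * (α * binom t n) : ℂ) * log (1 + z)
          + n.factorial * (α * binomDeriv t n + β * binom t n)) :=
        Filter.eventuallyEq_of_mem (Metric.isOpen_ball.mem_nhds hz) ih
      rw [hev.deriv_eq, (hder _ _ _ z hz).deriv]
      have hn : (n : ℂ) + 1 ≠ 0 := by exact_mod_cast n.succ_ne_zero
      simp only [binom, binomDeriv, Nat.factorial_succ]
      push_cast
      rw [show (t : ℂ) - n - 1 = t - (n + 1) by ring]
      congr 1
      field_simp
      ring
  have hd : DifferentiableOn ℂ f (Metric.ball 0 1) := fun z hz =>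
    (hder t α β z hz).differentiableAt.differentiableWithinAt
  have key := Complex.hasSum_taylorSeries_on_ball hd hz
  refine key.congr_fun ?_
  intro n
  rw [hiter n 0 (by simp)]
  have : (n.factorial : ℂ) ≠ 0 := by exact_mod_cast n.factorial_ne_zero
  simp
  field_simp

theorem hasSum_rpow_mul_log (t α β : ℝ) {w : ℝ} (hw : |w| < 1) :
    HasSum (fun k : ℕ => (α * binomDeriv t k + β * binom t k) * w ^ k)
      ((1 + w) ^ t * (α * Real.log (1 + w) + β)) := by
  have h := hasSum_cpow_mul_log t α β (z := (w : ℂ)) (by simpa using hw)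
  have h0 : 0 ≤ 1 + w := by linarith [(abs_lt.mp hw).1]
  rw [← Complex.hasSum_ofReal]
  convert h using 1
  · funext k; push_cast; ring
  · push_cast [Complex.ofReal_cpow h0, Complex.ofReal_log h0]; rfl

theorem mul_abs_binom_succ {t : ℝ} {k : ℕ} (h : t ≤ k) :
    ((k + 1 : ℕ) : ℝ) * |binom t (k + 1)| = (k - t) * |binom t k| := by
  have hk : (0:ℝ) < k + 1 := by positivity
  rw [binom, abs_div, abs_mul, abs_of_nonpos (sub_nonpos.2 h), abs_of_pos hk]
  push_cast
  field_simp
  ring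

theorem mul_abs_binomDeriv_succ_le {t : ℝ} {k : ℕ} (h : t ≤ k) :
    ((k + 1 : ℕ) : ℝ) * |binomDeriv t (k + 1)| ≤ (k - t) * |binomDeriv t k| + |binom t k| := by
  have hk : (0:ℝ) < k + 1 := by positivity
  rw [binomDeriv, abs_div, abs_of_pos hk]
  push_cast
  rw [mul_div_cancel₀ _ hk.ne']
  refine (abs_add_le _ _).trans (le_of_eq ?_)
  rw [abs_mul, abs_of_nonpos (sub_nonpos.2 h)]
  ring

theorem sum_abs_binom_le {t : ℝ} (ht : 0 < t) {N : ℕ} (hN : t ≤ N) (m : ℕ) :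
    ∑ k ∈ Finset.range m, |binom t (N + k)| ≤ N * |binom t N| / t := by
  have h : t * ∑ k ∈ Finset.range m, |binom t (N + k)|
      = N * |binom t N| - (N + m : ℕ) * |binom t (N + m)| := by
    induction m with
    | zero => simp
    | succ m ih =>
      have := mul_abs_binom_succ (t := t) (k := N + m) (by push_cast; linarith [m.cast_nonneg (α := ℝ)])
      rw [Finset.sum_range_succ, mul_add, ih, ← add_assoc, this]
      ring
  rw [le_div_iff₀ ht, mul_comm, h]
  exact sub_le_self _ (by positivity)

theorem sum_abs_binomDeriv_le {t : ℝ} (ht : 0 < t) {N : ℕ} (hN : t ≤ N) (m : ℕ) :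
    ∑ k ∈ Finset.range m, |binomDeriv t (N + k)|
      ≤ (N * |binomDeriv t N| + N * |binom t N| / t) / t := by
  have h : t * ∑ k ∈ Finset.range m, |binomDeriv t (N + k)|
      ≤ N * |binomDeriv t N| - (N + m : ℕ) * |binomDeriv t (N + m)|
        + ∑ k ∈ Finset.range m, |binom t (N + k)| := by
    induction m with
    | zero => simp
    | succ m ih =>
      have := mul_abs_binomDeriv_succ_le (t := t) (k := N + m)
        (by push_cast; linarith [m.cast_nonneg (α := ℝ)])
      rw [Finset.sum_range_succ, Finset.sum_range_succ, mul_add, ← add_assoc N m 1]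
      linarith
  rw [le_div_iff₀ ht, mul_comm]
  have h1 := sum_abs_binom_le ht hN m
  have h2 : (0:ℝ) ≤ (N + m : ℕ) * |binomDeriv t (N + m)| := by positivity
  linarith

theorem abs_sub_sum_le_of_hasSum {c : ℕ → ℝ} {w s τ : ℝ} {N : ℕ}
    (hs : HasSum (fun k => c k * w ^ k) s) (hw : |w| ≤ 1)
    (hτ : ∀ m, ∑ k ∈ Finset.range m, |c (N + k)| ≤ τ) :
    |s - ∑ k ∈ Finset.range N, c k * w ^ k| ≤ τ * |w| ^ N := by
  have h1 := (hs.tendsto_sum_nat.comp (Filter.tendsto_add_atTop_nat N)).sub_const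
    (∑ k ∈ Finset.range N, c k * w ^ k)
  refine le_of_tendsto h1.abs (Filter.Eventually.of_forall fun m => ?_)
  simp only [Function.comp]
  rw [add_comm m N, Finset.sum_range_add, add_sub_cancel_left]
  refine (Finset.abs_sum_le_sum_abs _ _).trans ?_
  refine le_trans ?_ (mul_le_mul_of_nonneg_right (hτ m) (pow_nonneg (abs_nonneg w) N))
  rw [Finset.sum_mul]
  refine Finset.sum_le_sum fun k _ => ?_
  rw [abs_mul, abs_pow, pow_add]
  exact mul_le_mul_of_nonneg_left
    (mul_le_of_le_one_right (by positivity) (pow_le_one₀ (abs_nonneg _) hw)) (abs_nonneg _)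

theorem rpow_sub_one_mul_mul_log {t u : ℝ} (ht : 1 < t) (hu : 0 ≤ u) :
    u ^ (t - 1) * (u * Real.log u) = u ^ t * Real.log u := by
  rw [← mul_assoc, ← Real.rpow_add_one' hu (by linarith), sub_add_cancel]

theorem continuous_rpow_sub_one_mul {t : ℝ} (ht : 1 < t) :
    Continuous (fun u : ℝ => u ^ (t - 1) * (u * Real.log u)) :=
  (Real.continuous_rpow_const (by linarith)).mul Real.continuous_mul_log

/-- Remainder of the binomial series, up to the left end of the interval of convergence. -/
theorem abs_rpow_sub_sum_le {t : ℝ} (ht : 1 < t) {N : ℕ} (hN : t ≤ N) {u : ℝ} (hu : 0 ≤ u)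
    (hu' : u < 2) :
    |u ^ t - ∑ k ∈ Finset.range N, binom t k * (u - 1) ^ k|
      ≤ N * |binom t N| / t * |u - 1| ^ N := by
  have hcl : IsClosed {u : ℝ | |u ^ t - ∑ k ∈ Finset.range N, binom t k * (u - 1) ^ k|
      ≤ N * |binom t N| / t * |u - 1| ^ N} := by
    refine isClosed_le ?_ (by fun_prop)
    have := Real.continuous_rpow_const (q := t) (by linarith)
    fun_prop
  have hmem : u ∈ closure (Set.Ioo (0:ℝ) 2) := by
    rw [closure_Ioo (by norm_num)]; exact ⟨hu, hu'.le⟩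
  refine closure_minimal ?_ hcl hmem
  intro u hu
  have hw : |u - 1| < 1 := by rw [abs_lt]; constructor <;> linarith [hu.1, hu.2]
  have h := hasSum_rpow_mul_log t 0 1 hw
  simp only [zero_mul, one_mul, zero_add, mul_one, add_sub_cancel] at h
  exact abs_sub_sum_le_of_hasSum h hw.le (sum_abs_binom_le (by linarith) hN)

theorem abs_rpow_mul_log_sub_sum_le {t : ℝ} (ht : 1 < t) {N : ℕ} (hN : t ≤ N) {u : ℝ}
    (hu : 0 ≤ u) (hu' : u < 2) :
    |u ^ (t - 1) * (u * Real.log u) - ∑ k ∈ Finset.range N, binomDeriv t k * (u - 1) ^ k|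
      ≤ (N * |binomDeriv t N| + N * |binom t N| / t) / t * |u - 1| ^ N := by
  have hcl : IsClosed {u : ℝ | |u ^ (t - 1) * (u * Real.log u)
      - ∑ k ∈ Finset.range N, binomDeriv t k * (u - 1) ^ k|
      ≤ (N * |binomDeriv t N| + N * |binom t N| / t) / t * |u - 1| ^ N} := by
    refine isClosed_le ?_ (by fun_prop)
    have := continuous_rpow_sub_one_mul ht
    fun_prop
  have hmem : u ∈ closure (Set.Ioo (0:ℝ) 2) := by
    rw [closure_Ioo (by norm_num)]; exact ⟨hu, hu'.le⟩
  refine closure_minimal ?_ hcl hmem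
  intro u hu
  have hw : |u - 1| < 1 := by rw [abs_lt]; constructor <;> linarith [hu.1, hu.2]
  have h := hasSum_rpow_mul_log t 1 0 hw
  simp only [zero_mul, one_mul, add_zero, add_sub_cancel] at h
  rw [Set.mem_ofPred_eq, rpow_sub_one_mul_mul_log ht hu.1.le]
  exact abs_sub_sum_le_of_hasSum h hw.le (sum_abs_binomDeriv_le (by linarith) hN)

end BinomialSeries

section Derivative

theorem gFun_eq_sq_add_sq {σ : ℤ} (hσ : σ ^ 2 = 1) (x : ℝ) :
    gFun σ x = (1 + Real.cos (2 * Real.pi * x) + σ * Real.cos (14 * Real.pi * x)) ^ 2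
      + (Real.sin (2 * Real.pi * x) + σ * Real.sin (14 * Real.pi * x)) ^ 2 := by
  have h := Real.cos_sub (14 * Real.pi * x) (2 * Real.pi * x)
  rw [show 14 * Real.pi * x - 2 * Real.pi * x = 12 * Real.pi * x by ring] at h
  have h1 := Real.sin_sq_add_cos_sq (2 * Real.pi * x)
  have h7 := Real.sin_sq_add_cos_sq (14 * Real.pi * x)
  have hs : (σ : ℝ) ^ 2 = 1 := by exact_mod_cast hσ
  rw [gFun, h]
  linear_combination (-1) * h1 - (σ : ℝ) ^ 2 * h7 - hs

theorem gFun_nonneg {σ : ℤ} (hσ : σ ^ 2 = 1) (x : ℝ) : 0 ≤ gFun σ x := by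
  rw [gFun_eq_sq_add_sq hσ]; positivity

theorem gFun_le_nine {σ : ℤ} (hσ : σ ^ 2 = 1) (x : ℝ) : gFun σ x ≤ 9 := by
  have h : ∀ y, (σ : ℝ) * Real.cos y ≤ 1 := by
    intro y
    have hs : |(σ : ℝ)| = 1 := by
      rw [← sq_eq_sq₀ (abs_nonneg _) zero_le_one, sq_abs]; exact_mod_cast hσ
    refine (le_abs_self _).trans ?_
    rw [abs_mul, hs, one_mul]
    exact Real.abs_cos_le_one y
  have h1 := Real.cos_le_one (2 * Real.pi * x)
  have h2 := h (12 * Real.pi * x)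
  have h3 := h (14 * Real.pi * x)
  rw [gFun]; linarith

theorem continuous_gFun (σ : ℤ) : Continuous (gFun σ) := by unfold gFun; fun_prop

theorem hasDerivAt_const_rpow_of_nonneg {v t : ℝ} (hv : 0 ≤ v) (ht : 0 < t) :
    HasDerivAt (fun s : ℝ => v ^ s) (v ^ t * Real.log v) t := by
  rcases hv.eq_or_lt with rfl | hv
  · rw [Real.log_zero, mul_zero]
    refine (hasDerivAt_const t (0:ℝ)).congr_of_eventuallyEq ?_
    filter_upwards [lt_mem_nhds ht] with s hs using Real.zero_rpow hs.ne'
  · simpa [mul_comm] using (hasDerivAt_id t).const_rpow hv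

theorem hasDerivAt_integral_gFun_rpow {σ : ℤ} (hσ : σ ^ 2 = 1) {t : ℝ} (ht : 2 < t) :
    HasDerivAt (fun s => ∫ x in (0:ℝ)..(1/2), gFun σ x ^ s)
      (∫ x in (0:ℝ)..(1/2), gFun σ x ^ (t - 1) * (gFun σ x * Real.log (gFun σ x))) t := by
  obtain ⟨C, hC⟩ := (isCompact_Icc (a := (0:ℝ)) (b := 9)).exists_bound_of_continuousOn
    Real.continuous_mul_log.continuousOn
  have hg := continuous_gFun σ
  have hcont : ∀ s : ℝ, 0 < s → Continuous (fun x => gFun σ x ^ s) := fun s hs =>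
    (Real.continuous_rpow_const hs.le).comp hg
  refine (intervalIntegral.hasDerivAt_integral_of_dominated_loc_of_deriv_le
    (F := fun s x => gFun σ x ^ s)
    (F' := fun s x => gFun σ x ^ (s - 1) * (gFun σ x * Real.log (gFun σ x)))
    (bound := fun _ => 9 ^ t * C) (Metric.ball_mem_nhds t one_pos) ?_ ?_ ?_ ?_ ?_ ?_).2
  · filter_upwards [lt_mem_nhds (show 0 < t by linarith)] with s hs
    exact (hcont s hs).aestronglyMeasurable
  · exact (hcont t (by linarith)).intervalIntegrable _ _
  · exact ((continuous_rpow_sub_one_mul (by linarith)).comp hg).aestronglyMeasurable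
  · refine Filter.Eventually.of_forall fun x _ s hs => ?_
    rw [Metric.mem_ball, Real.dist_eq, abs_lt] at hs
    have h0 := gFun_nonneg hσ x
    have h9 := gFun_le_nine hσ x
    rw [norm_mul]
    refine mul_le_mul ?_ (hC _ ⟨h0, h9⟩) (norm_nonneg _) (by positivity)
    rw [Real.norm_of_nonneg (by positivity)]
    exact (Real.rpow_le_rpow h0 h9 (by linarith)).trans
      (Real.rpow_le_rpow_of_exponent_le (by norm_num) (by linarith))
  · exact intervalIntegrable_const
  · refine Filter.Eventually.of_forall fun x _ s hs => ?_
    rw [Metric.mem_ball, Real.dist_eq, abs_lt] at hs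
    rw [rpow_sub_one_mul_mul_log (by linarith) (gFun_nonneg hσ x)]
    exact hasDerivAt_const_rpow_of_nonneg (gFun_nonneg hσ x) (by linarith)

theorem d_eq (t : ℝ) (ht : 0 < t) :
    d t = (∫ x in (0:ℝ)..(1/2), gFun (-1) x ^ t) - ∫ x in (0:ℝ)..(1/2), gFun 1 x ^ t := by
  rw [← intervalIntegral.integral_sub]
  · rw [d]
    congr 1
    funext x
    simp only [Gm, Gp, gFun]
    congr 2 <;> (push_cast; ring)
  all_goals exact ((Real.continuous_rpow_const ht.le).comp (continuous_gFun _)).intervalIntegrable _ _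

theorem rpow_mul_log_rescale {t v : ℝ} (ht : 1 < t) (hv : 0 ≤ v) :
    v ^ (t - 1) * (v * Real.log v) = 5 ^ t * (Real.log 5 * (v / 5) ^ t
      + (v / 5) ^ (t - 1) * (v / 5 * Real.log (v / 5))) := by
  rw [rpow_sub_one_mul_mul_log ht hv, rpow_sub_one_mul_mul_log ht (by positivity)]
  rcases hv.eq_or_lt with rfl | hv
  · rw [zero_div, Real.zero_rpow (by linarith)]; simp
  · rw [Real.log_div hv.ne' (by norm_num), Real.div_rpow hv.le (by norm_num)]
    have : (5:ℝ) ^ t ≠ 0 := by positivity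
    field_simp
    ring

/-- `∫ (G₋/5)ᵗ - (G₊/5)ᵗ`. -/
noncomputable def powDiff (t : ℝ) : ℝ :=
  (∫ x in (0:ℝ)..(1/2), (gFun (-1) x / 5) ^ t) - ∫ x in (0:ℝ)..(1/2), (gFun 1 x / 5) ^ t

/-- `∫ (G₋/5)ᵗ log (G₋/5) - (G₊/5)ᵗ log (G₊/5)`. -/
noncomputable def powLogDiff (t : ℝ) : ℝ :=
  (∫ x in (0:ℝ)..(1/2), (gFun (-1) x / 5) ^ (t - 1) * (gFun (-1) x / 5 * Real.log (gFun (-1) x / 5)))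
  - ∫ x in (0:ℝ)..(1/2), (gFun 1 x / 5) ^ (t - 1) * (gFun 1 x / 5 * Real.log (gFun 1 x / 5))

theorem deriv_d_eq {t : ℝ} (ht : 2 < t) :
    deriv d t = 5 ^ t * (Real.log 5 * powDiff t + powLogDiff t) := by
  have hd : HasDerivAt d _ t :=
    ((hasDerivAt_integral_gFun_rpow (σ := -1) (by norm_num) ht).sub
      (hasDerivAt_integral_gFun_rpow (σ := 1) (by norm_num) ht)).congr_of_eventuallyEq (by
        filter_upwards [lt_mem_nhds (show 0 < t by linarith)] with s hs using d_eq s hs)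
  have hsplit : ∀ σ : ℤ, σ ^ 2 = 1 →
      ∫ x in (0:ℝ)..(1/2), gFun σ x ^ (t - 1) * (gFun σ x * Real.log (gFun σ x)) =
      5 ^ t * (Real.log 5 * (∫ x in (0:ℝ)..(1/2), (gFun σ x / 5) ^ t)
      + ∫ x in (0:ℝ)..(1/2), (gFun σ x / 5) ^ (t - 1) * (gFun σ x / 5 * Real.log (gFun σ x / 5))) := by
    intro σ hσ
    have hg : Continuous fun x => gFun σ x / 5 := (continuous_gFun σ).div_const 5
    rw [← intervalIntegral.integral_const_mul, ← intervalIntegral.integral_add,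
      ← intervalIntegral.integral_const_mul]
    · congr 1
      funext x
      exact rpow_mul_log_rescale (by linarith) (gFun_nonneg hσ x)
    · exact (((Real.continuous_rpow_const (by linarith)).comp hg).const_mul _).intervalIntegrable _ _
    · exact ((continuous_rpow_sub_one_mul (by linarith)).comp hg).intervalIntegrable _ _
  rw [hd.deriv, hsplit _ (by norm_num), hsplit _ (by norm_num), powDiff, powLogDiff]
  ring

/-- Integrating a polynomial approximation of `φ` in powers of `u - 1` against the
difference of the distributions of `G₋/5` and `G₊/5`. -/
theorem sum_moments_sub_le {φ : ℝ → ℝ} {c : ℕ → ℝ} {τ : ℝ} {N : ℕ} (hN : Even N)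
    (hφ : Continuous φ)
    (h : ∀ u, 0 ≤ u → u < 2 → |φ u - ∑ k ∈ Finset.range N, c k * (u - 1) ^ k| ≤ τ * |u - 1| ^ N) :
    ∑ k ∈ Finset.range N, c k * (((gMoment (-1) k - gMoment 1 k : ℤ) : ℝ) / (2 * 5 ^ k))
      - τ * (((gMoment (-1) N + gMoment 1 N : ℤ) : ℝ) / (2 * 5 ^ N))
    ≤ (∫ x in (0:ℝ)..(1/2), φ (gFun (-1) x / 5)) - ∫ x in (0:ℝ)..(1/2), φ (gFun 1 x / 5) := by
  have main : ∀ σ : ℤ, σ ^ 2 = 1 →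
      |(∫ x in (0:ℝ)..(1/2), φ (gFun σ x / 5))
        - ∑ k ∈ Finset.range N, c k * ((gMoment σ k : ℝ) / (2 * 5 ^ k))|
      ≤ τ * ((gMoment σ N : ℝ) / (2 * 5 ^ N)) := by
    intro σ hσ
    have hg : Continuous fun x => gFun σ x / 5 := (continuous_gFun σ).div_const 5
    have hφg : Continuous fun x => φ (gFun σ x / 5) := hφ.comp hg
    simp_rw [← integral_gFun_pow, ← intervalIntegral.integral_const_mul]
    rw [← intervalIntegral.integral_finsetSum, ← intervalIntegral.integral_sub]
    · rw [← Real.norm_eq_abs]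
      refine intervalIntegral.norm_integral_le_of_norm_le (by norm_num)
        (Filter.Eventually.of_forall fun x _ => ?_) (Continuous.intervalIntegrable (by fun_prop) _ _)
      have h0 := gFun_nonneg hσ x
      have h9 := gFun_le_nine hσ x
      rw [Real.norm_eq_abs, ← hN.pow_abs]
      exact h _ (by positivity) (by linarith)
    · exact hφg.intervalIntegrable _ _
    · exact Continuous.intervalIntegrable (by fun_prop) _ _
    · exact fun k _ => Continuous.intervalIntegrable (by fun_prop) _ _
  have h1 := (abs_le.mp (main (-1) (by norm_num))).1
  have h2 := (abs_le.mp (main 1 (by norm_num))).2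
  push_cast
  simp_rw [sub_div, mul_sub, Finset.sum_sub_distrib, add_div, mul_add]
  linarith

end Derivative

section Certificate

/-- `200 ^ k * k!` times the polynomial `s ↦ binom ((1105 + 39 * s) / 200) k`. -/
def binomL : ℕ → List ℤ
  | 0 => [1]
  | k + 1 => lMul [1105 - 200 * k, 39] (binomL k)

/-- `200 ^ k * k!` times the polynomial `s ↦ binomDeriv ((1105 + 39 * s) / 200) k`. -/
def binomDerivL : ℕ → List ℤ
  | 0 => []
  | k + 1 => lAdd (lMul [1105 - 200 * k, 39] (binomDerivL k)) (lSmul 200 (binomL k))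

/-- `∑ k < n, c k * M k`, brought to a common denominator. -/
def momentSumL (c : ℕ → List ℤ) (M : ℕ → ℤ) : ℕ → List ℤ
  | 0 => []
  | n + 1 => lSmul (1000 * (n + 1)) (lAdd (momentSumL c M n) (lSmul (M n) (c n)))

theorem lEval_binomL (s : ℝ) (k : ℕ) :
    lEval (binomL k) s = 200 ^ k * k.factorial * binom ((1105 + 39 * s) / 200) k := by
  induction k with
  | zero => simp [binomL, binom, lEval]
  | succ k ih =>
    rw [binomL, lEval_mul, ih, binom, Nat.factorial_succ]
    simp only [lEval]
    push_cast
    field_simp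
    ring

theorem lEval_binomDerivL (s : ℝ) (k : ℕ) :
    lEval (binomDerivL k) s = 200 ^ k * k.factorial * binomDeriv ((1105 + 39 * s) / 200) k := by
  induction k with
  | zero => simp [binomDerivL, binomDeriv, lEval]
  | succ k ih =>
    rw [binomDerivL, lEval_add, lEval_mul, lEval_smul, ih, lEval_binomL, binomDeriv,
      Nat.factorial_succ]
    simp only [lEval]
    push_cast
    field_simp
    ring

theorem lEval_momentSumL {c : ℕ → List ℤ} {y : ℕ → ℝ} {s : ℝ}
    (h : ∀ k, lEval (c k) s = 200 ^ k * k.factorial * y k) (M : ℕ → ℤ) (n : ℕ) :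
    lEval (momentSumL c M n) s
      = 2 * 1000 ^ n * n.factorial * ∑ k ∈ Finset.range n, y k * (M k / (2 * 5 ^ k)) := by
  induction n with
  | zero => simp [momentSumL, lEval]
  | succ n ih =>
    rw [momentSumL, lEval_smul, lEval_add, lEval_smul, ih, h, Finset.sum_range_succ,
      Nat.factorial_succ, show (1000:ℝ) ^ n = 200 ^ n * 5 ^ n by rw [← mul_pow]; norm_num,
      pow_succ (1000:ℝ), show (1000:ℝ) ^ n = 200 ^ n * 5 ^ n by rw [← mul_pow]; norm_num]
    push_cast
    field_simp

/-- Twice the `k`-th moments of `G₋ - 5` minus those of `G₊ - 5`. -/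
def momentDiff (k : ℕ) : ℤ :=
  [0, 0, 0, 0, 0, 0, 0, -28, -256, 288, -14760, 48840, -542784, 2136992, -16160144, 67413060, -422040320, 1790241440, -9982711440, 42073576896].getD k 0

set_option maxRecDepth 10000 in
theorem gMoment_sub : ∀ k < 20, gMoment (-1) k - gMoment 1 k = momentDiff k := by
  decide +kernel

set_option maxRecDepth 10000 in
theorem gMoment_add : 10000 * (gMoment (-1) 20 + gMoment 1 20) ≤ 487 * (2 * 5 ^ 20) := by
  decide +kernel

theorem lNorm_binomL : 10 ^ 7 * lNorm (binomL 20) ≤ 12 * (200 ^ 20 * Nat.factorial 20) := by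
  decide +kernel

theorem lNorm_binomDerivL :
    10 ^ 7 * lNorm (binomDerivL 20) ≤ 28 * (200 ^ 20 * Nat.factorial 20) := by
  decide +kernel

theorem lLower_powDiff : 5 * (2 * 1000 ^ 20 * Nat.factorial 20)
    ≤ 10 ^ 7 * lLower (momentSumL binomL momentDiff 20) := by
  decide +kernel

theorem lLower_deriv : 5 * 34 * (2 * 1000 ^ 20 * Nat.factorial 20)
    ≤ 10 ^ 7 * lLower (lAdd (lSmul 8 (momentSumL binomL momentDiff 20))
        (lSmul 5 (momentSumL binomDerivL momentDiff 20))) := by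
  decide +kernel

theorem eight_fifths_le_log_five : (8 / 5 : ℝ) ≤ Real.log 5 := by
  rw [Real.le_log_iff_exp_le (by norm_num), ← pow_le_pow_iff_left₀ (Real.exp_pos _).le (by norm_num)
    (show 5 ≠ 0 by norm_num), ← Real.exp_nat_mul]
  calc Real.exp ((5 : ℕ) * (8 / 5)) = Real.exp 1 ^ 8 := by
        rw [← Real.exp_nat_mul]; norm_num
    _ ≤ 2.7182818286 ^ 8 := pow_le_pow_left₀ (Real.exp_pos _).le Real.exp_one_lt_d9.le 8
    _ ≤ 5 ^ 5 := by norm_num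

end Certificate

theorem stmt14 : ∀ t : ℝ, 5.33 ≤ t → t ≤ 5.72 → 0 < deriv d t := by
  intro t ht1 ht2
  obtain ⟨s, rfl⟩ : ∃ s : ℝ, t = (1105 + 39 * s) / 200 := ⟨(200 * t - 1105) / 39, by ring⟩
  have hs : |s| ≤ 1 := by rw [abs_le]; constructor <;> linarith
  have e1 := lEval_momentSumL (lEval_binomL s) momentDiff 20
  have e2 := lEval_momentSumL (lEval_binomDerivL s) momentDiff 20
  have l1 := lLower_le_lEval (momentSumL binomL momentDiff 20) hs
  have l2 := lLower_le_lEval (lAdd (lSmul 8 (momentSumL binomL momentDiff 20))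
    (lSmul 5 (momentSumL binomDerivL momentDiff 20))) hs
  rw [lEval_add, lEval_smul, lEval_smul, e1, e2] at l2
  rw [e1] at l1
  have n1 := abs_lEval_le (binomL 20) hs
  have n2 := abs_lEval_le (binomDerivL 20) hs
  rw [lEval_binomL, abs_mul, abs_of_pos (by positivity)] at n1
  rw [lEval_binomDerivL, abs_mul, abs_of_pos (by positivity)] at n2
  generalize (1105 + 39 * s) / 200 = t at *
  have c1 : (10:ℝ) ^ 7 * lNorm (binomL 20) ≤ 12 * (200 ^ 20 * Nat.factorial 20) := by
    exact_mod_cast lNorm_binomL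
  have c2 : (10:ℝ) ^ 7 * lNorm (binomDerivL 20) ≤ 28 * (200 ^ 20 * Nat.factorial 20) := by
    exact_mod_cast lNorm_binomDerivL
  have c3 : 5 * (2 * 1000 ^ 20 * Nat.factorial 20)
    ≤ (10:ℝ) ^ 7 * lLower (momentSumL binomL momentDiff 20) := by exact_mod_cast lLower_powDiff
  have c4 : 5 * 34 * (2 * 1000 ^ 20 * Nat.factorial 20)
    ≤ (10:ℝ) ^ 7 * lLower (lAdd (lSmul 8 (momentSumL binomL momentDiff 20))
        (lSmul 5 (momentSumL binomDerivL momentDiff 20))) := by exact_mod_cast lLower_deriv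
  have c5 : 10000 * ((gMoment (-1) 20 + gMoment 1 20 : ℤ) : ℝ) ≤ 487 * (2 * 5 ^ 20) := by
    exact_mod_cast gMoment_add
  have i1 := sum_moments_sub_le (N := 20) (by decide)
    (Real.continuous_rpow_const (q := t) (by linarith))
    (fun u hu hu' => abs_rpow_sub_sum_le (by linarith) (by push_cast; linarith) hu hu')
  have i2 := sum_moments_sub_le (N := 20) (by decide)
    (continuous_rpow_sub_one_mul (t := t) (by linarith))
    (fun u hu hu' => abs_rpow_mul_log_sub_sum_le (by linarith) (by push_cast; linarith) hu hu')
  rw [← powDiff] at i1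
  rw [← powLogDiff] at i2
  have hM : ∀ c : ℕ → ℝ, ∑ k ∈ Finset.range 20,
      c k * (((gMoment (-1) k - gMoment 1 k : ℤ) : ℝ) / (2 * 5 ^ k))
      = ∑ k ∈ Finset.range 20, c k * ((momentDiff k : ℝ) / (2 * 5 ^ k)) := fun c =>
    Finset.sum_congr rfl fun k hk => by rw [gMoment_sub k (Finset.mem_range.1 hk)]
  rw [hM] at i1 i2
  have a1 : |binom t 20| ≤ 12 / 10 ^ 7 := by
    have h := c1.trans' (mul_le_mul_of_nonneg_left n1 (by positivity))
    generalize |binom t 20| = z at h ⊢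
    norm_num [Nat.factorial] at h ⊢
    linarith
  have a2 : |binomDeriv t 20| ≤ 28 / 10 ^ 7 := by
    have h := c2.trans' (mul_le_mul_of_nonneg_left n2 (by positivity))
    generalize |binomDeriv t 20| = z at h ⊢
    norm_num [Nat.factorial] at h ⊢
    linarith
  set S := ∑ k ∈ Finset.range 20, binom t k * ((momentDiff k : ℝ) / (2 * 5 ^ k))
  set S' := ∑ k ∈ Finset.range 20, binomDeriv t k * ((momentDiff k : ℝ) / (2 * 5 ^ k))
  have b1 : 5 / 10 ^ 7 ≤ S := by
    have h := c3.trans (mul_le_mul_of_nonneg_left l1 (by positivity))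
    norm_num [Nat.factorial] at h ⊢
    linarith
  have b2 : 34 / 10 ^ 7 ≤ 8 / 5 * S + S' := by
    have h := c4.trans (mul_le_mul_of_nonneg_left l2 (by positivity))
    norm_num [Nat.factorial] at h ⊢
    linarith
  set B := ((gMoment (-1) 20 + gMoment 1 20 : ℤ) : ℝ) / (2 * 5 ^ 20) with hB
  have hB1 : B ≤ 487 / 10000 := by
    rw [hB, div_le_iff₀ (by positivity)]; linarith
  have tA : (20 : ℕ) * |binom t 20| / t ≤ 46 / 10 ^ 7 := by
    rw [div_le_iff₀ (by linarith)]; push_cast; linarith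
  have tA0 : 0 ≤ (20 : ℕ) * |binom t 20| / t :=
    div_nonneg (mul_nonneg (Nat.cast_nonneg _) (abs_nonneg _)) (by linarith)
  have tB : ((20 : ℕ) * |binomDeriv t 20| + (20 : ℕ) * |binom t 20| / t) / t ≤ 120 / 10 ^ 7 := by
    rw [div_le_iff₀ (by linarith)]; push_cast at tA ⊢; linarith
  have tB0 : 0 ≤ ((20 : ℕ) * |binomDeriv t 20| + (20 : ℕ) * |binom t 20| / t) / t :=
    div_nonneg (add_nonneg (mul_nonneg (Nat.cast_nonneg _) (abs_nonneg _)) tA0) (by linarith)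
  have r1 := (mul_le_mul_of_nonneg_left hB1 tA0).trans
    (mul_le_mul_of_nonneg_right tA (by norm_num))
  have r2 := (mul_le_mul_of_nonneg_left hB1 tB0).trans
    (mul_le_mul_of_nonneg_right tB (by norm_num))
  rw [deriv_d_eq (by linarith)]
  refine mul_pos (Real.rpow_pos_of_pos (by norm_num) t) ?_
  have hpos : 0 ≤ powDiff t := by norm_num at *; linarith
  have := mul_le_mul_of_nonneg_right eight_fifths_le_log_five hpos
  norm_num at *
  linarith
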